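/- (Gilbarg–Trudinger type regularity) Let Ω ⊂ ℝ^m be a bounded domain with C^k-smooth boundary, k ≥ 2, and let Σ be the cut locus of Ω. Then the distance function d_{∂Ω} is C^k smooth on the set cl(Ω) \ Σ (the closure of Ω with the cut locus removed). -/

import Mathlib

open MeasureTheory Metric Filter Topology Set
open scoped ENNReal

noncomputable section

/-- The medial axis of `Ω`: points of `Ω` with more than one nearest boundary point. -/
def medialAxis {X : Type*} [MetricSpace X] (Ω : Set X) : Set X :=
  {x ∈ Ω | ∃ y ∈ frontier Ω, ∃ z ∈ frontier Ω, y ≠ z ∧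
    dist x y = infDist x (frontier Ω) ∧ dist x z = infDist x (frontier Ω)}

/-- The cut locus of `Ω`: the closure of the medial axis in `Ω`. -/
def cutLocus {X : Type*} [MetricSpace X] (Ω : Set X) : Set X :=
  closure (medialAxis Ω) ∩ Ω

/-- `ρ` is a `C^k` local defining function for the domain `Ω` near the boundary point `p`,
defined on the open neighborhood `V`: it is `C^k` on `V`, has nonvanishing gradient on the
boundary, is negative exactly on `Ω ∩ V` and vanishes exactly on `∂Ω ∩ V`. -/
def IsLocalDefiningFunction {F : Type*} [NormedAddCommGroup F] [NormedSpace ℝ F]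
    (Ω : Set F) (k : ℕ∞) (p : F) (V : Set F) (ρ : F → ℝ) : Prop :=
  IsOpen V ∧ p ∈ V ∧ ContDiffOn ℝ k ρ V ∧
    (∀ q ∈ V ∩ frontier Ω, fderiv ℝ ρ q ≠ 0) ∧
    Ω ∩ V = {q | q ∈ V ∧ ρ q < 0} ∧ frontier Ω ∩ V = {q | q ∈ V ∧ ρ q = 0}

/-- `Ω` has `C^k`-smooth boundary: every boundary point admits a `C^k` local defining
function. -/
def HasCkBoundary {F : Type*} [NormedAddCommGroup F] [NormedSpace ℝ F]
    (Ω : Set F) (k : ℕ∞) : Prop :=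
  ∀ p ∈ frontier Ω, ∃ V ρ, IsLocalDefiningFunction Ω k p V ρ

section EuclideanGeometry

variable {E : Type*} [NormedAddCommGroup E] [InnerProductSpace ℝ E]

lemma ball_subset_of_le_dist_frontier {Ω : Set E} (hΩ : IsOpen Ω) {x y : E} {R : ℝ}
    (hx : x ∈ Ω) (hxy : x ∈ ball y R) (h : ∀ q ∈ frontier Ω, R ≤ dist y q) :
    ball y R ⊆ Ω := by
  refine IsPreconnected.subset_left_of_subset_union hΩ isClosed_closure.isOpen_compl
    (disjoint_compl_right.mono_left subset_closure) (fun z hz => ?_) ⟨x, hxy, hx⟩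
    (convex_ball y R).isPreconnected
  by_contra hc
  simp only [mem_union, mem_compl_iff, not_or, not_not] at hc
  have := h z (by rw [hΩ.frontier_eq]; exact ⟨hc.2, hc.1⟩)
  rw [mem_ball, dist_comm] at hz
  linarith

variable [CompleteSpace E]

lemma ContDiffAt.gradient_right {f : E → ℝ} {x : E} {n : ℕ} (hf : ContDiffAt ℝ (n + 1) f x) :
    ContDiffAt ℝ n (gradient f) x :=
  (InnerProductSpace.toDual ℝ E).symm.toContinuousLinearEquiv.contDiff.contDiffAt.comp x
    hf.fderiv_right_succ

/-- First-order condition: if `ρ < 0` inside the ball centred at `y` having `p` on its boundary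
sphere and `ρ p = 0`, then `y - p` points in the direction of `-∇ρ(p)`. -/
lemma norm_smul_sub_eq_of_ball_neg {ρ : E → ℝ} {p y : E} (hρ : DifferentiableAt ℝ ρ p)
    (hp : ρ p = 0) (h : ∀ᶠ z in 𝓝 p, ‖z - y‖ < ‖p - y‖ → ρ z < 0) :
    ‖gradient ρ p‖ • (y - p) = -(‖y - p‖ • gradient ρ p) := by
  set g := gradient ρ p with hg
  set u := y - p with hu
  have key : ∀ w : E, 0 < inner ℝ u w → inner ℝ g w ≤ 0 := by
    intro w hw
    by_contra! hgw
    have hd : HasDerivAt (fun t : ℝ => ρ (p + t • w)) (inner ℝ g w) 0 := by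
      have hc : HasDerivAt (fun t : ℝ => p + t • w) w 0 := by
        simpa using ((hasDerivAt_id (0 : ℝ)).smul_const w).const_add p
      have := HasFDerivAt.comp_hasDerivAt (x := (0 : ℝ)) (f := fun t : ℝ => p + t • w)
        (l := ρ) (l' := fderiv ℝ ρ p) (by simpa using hρ.hasFDerivAt) hc
      rwa [← inner_gradient_left] at this
    have hd' : HasDerivAt (fun t : ℝ => ‖p + t • w - y‖ ^ 2) (-(2 * inner ℝ u w)) 0 := by
      have hc : HasDerivAt (fun t : ℝ => p + t • w - y) w 0 := by
        simpa using (((hasDerivAt_id (0 : ℝ)).smul_const w).const_add p).sub_const y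
      convert hc.norm_sq using 1
      simp only [zero_smul, add_zero]
      rw [hu, ← neg_sub p y, inner_neg_left]; ring
    have hcont : Tendsto (fun t : ℝ => p + t • w) (𝓝[>] 0) (𝓝 p) := by
      have : Continuous fun t : ℝ => p + t • w := by fun_prop
      exact tendsto_nhdsWithin_of_tendsto_nhds (by simpa using this.tendsto 0)
    have e1 := (hasDerivAt_iff_tendsto_slope_zero.1 hd).mono_left
      (nhdsWithin_mono 0 (fun t (ht : 0 < t) => ne_of_gt ht) : 𝓝[>] (0 : ℝ) ≤ 𝓝[≠] 0)
    have e2 := (hasDerivAt_iff_tendsto_slope_zero.1 hd').mono_left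
      (nhdsWithin_mono 0 (fun t (ht : 0 < t) => ne_of_gt ht) : 𝓝[>] (0 : ℝ) ≤ 𝓝[≠] 0)
    obtain ⟨t, h1, h2, h3, ht⟩ := (((tendsto_order.1 e1).1 0 hgw).and
      (((tendsto_order.1 e2).2 0 (by linarith)).and
        ((hcont.eventually h).and self_mem_nhdsWithin))).exists
    have ht : 0 < t := ht
    simp only [zero_add, zero_smul, add_zero, hp, sub_zero, smul_eq_mul] at h1 h2
    have h1 := (pos_iff_pos_of_mul_pos h1).1 (inv_pos.2 ht)
    have h2 : ‖p + t • w - y‖ ^ 2 - ‖p - y‖ ^ 2 < 0 := by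
      by_contra! hc
      exact absurd h2 (not_lt.2 (mul_nonneg (inv_pos.2 ht).le hc))
    have := h3 (lt_of_pow_lt_pow_left₀ 2 (norm_nonneg _) (by linarith))
    linarith
  have hcs : -(‖u‖ * ‖g‖) ≤ inner ℝ u g := (abs_le.1 (abs_real_inner_le_norm u g)).1
  have heq : inner ℝ u g = -(‖u‖ * ‖g‖) := by
    by_cases hu0 : u = 0
    · simp [hu0]
    by_cases hg0 : g = 0
    · simp [hg0]
    have hun := norm_pos_iff.2 hu0
    have hgn := norm_pos_iff.2 hg0
    by_contra hne
    have hlt : 0 < inner ℝ u g + ‖u‖ * ‖g‖ := by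
      have := lt_of_le_of_ne hcs (Ne.symm hne)
      linarith
    have a1 : inner ℝ u (‖g‖ • u + ‖u‖ • g) = ‖u‖ * (inner ℝ u g + ‖u‖ * ‖g‖) := by
      rw [inner_add_right, inner_smul_right, inner_smul_right, real_inner_self_eq_norm_sq]; ring
    have a2 : inner ℝ g (‖g‖ • u + ‖u‖ • g) = ‖g‖ * (inner ℝ u g + ‖u‖ * ‖g‖) := by
      rw [inner_add_right, inner_smul_right, inner_smul_right, real_inner_self_eq_norm_sq,
        real_inner_comm]; ring
    have := key _ (a1 ▸ mul_pos hun hlt)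
    rw [a2] at this
    exact absurd this (not_le.2 (mul_pos hgn hlt))
  have := inner_eq_norm_mul_iff_real (x := u) (y := -g)
  rw [inner_neg_right, heq, norm_neg, neg_neg] at this
  rw [this.1 rfl, smul_neg]

/-- Second-order condition at a point of `{ρ = 0}` touched from inside by a ball. -/
lemma sq_norm_add_mul_inner_nonneg_of_ball_neg {ρ : E → ℝ} {p y : E} {l : ℝ}
    (hρ : ContDiffAt ℝ 2 ρ p) (hp : ρ p = 0) (hg : gradient ρ p ≠ 0)
    (hy : y = p + l • gradient ρ p) (hl : l ≤ 0)
    (h : ∀ᶠ z in 𝓝 p, ‖z - y‖ < ‖p - y‖ → ρ z < 0) {v : E}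
    (hv : inner ℝ (gradient ρ p) v = 0) :
    0 ≤ ‖v‖ ^ 2 + l * inner ℝ (fderiv ℝ (gradient ρ) p v) v := by
  rcases hl.eq_or_lt with rfl | hl
  · simp
  by_contra! hneg
  set g := gradient ρ p
  set H := fderiv ℝ (gradient ρ) p
  have hlt : -(inner ℝ (H v) v / 2) < ‖v‖ ^ 2 / (2 * l) := by
    rw [lt_div_iff_of_neg (by linarith)]; nlinarith
  obtain ⟨s, hs1, hs2⟩ := exists_between hlt
  have hgn : ‖g‖ ^ 2 ≠ 0 := by simpa using hg
  set w := (s / ‖g‖ ^ 2) • g with hw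
  have hgw : inner ℝ g w = s := by
    rw [hw, inner_smul_right, real_inner_self_eq_norm_sq]; field_simp
  set c : ℝ → E := fun t => p + t • v + t ^ 2 • w with hc
  have hc0 : c 0 = p := by simp [hc]
  have hc' : ∀ t, HasDerivAt c (v + (2 * t) • w) t := fun t => by
    have := (((hasDerivAt_id t).smul_const v).const_add p).add
      ((hasDerivAt_pow 2 t).smul_const w)
    convert! this using 1
    simp
  have hcc : Tendsto c (𝓝 0) (𝓝 p) := by
    simpa [hc0] using (hc' 0).continuousAt.tendsto
  have hd : ∀ᶠ t in 𝓝 (0 : ℝ),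
      HasDerivAt (fun t => ρ (c t)) (inner ℝ (gradient ρ (c t)) (v + (2 * t) • w)) t := by
    have h1 : ∀ᶠ z in 𝓝 p, DifferentiableAt ℝ ρ z :=
      (hρ.eventually (by simp)).mono fun z hz => hz.differentiableAt (by simp)
    filter_upwards [hcc.eventually h1] with t ht
    have := ht.hasFDerivAt.comp_hasDerivAt t (hc' t)
    rwa [← inner_gradient_left] at this
  have hgr : HasFDerivAt (gradient ρ) H p :=
    ((ContDiffAt.gradient_right (n := 1) (by simpa [one_add_one_eq_two] using hρ)).differentiableAt
      (by simp)).hasFDerivAt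
  have hdd : HasDerivAt (fun t => inner ℝ (gradient ρ (c t)) (v + (2 * t) • w))
      (2 * s + inner ℝ (H v) v) 0 := by
    have h1 : HasDerivAt (fun t => gradient ρ (c t)) (H v) 0 := by
      have := HasFDerivAt.comp_hasDerivAt (x := (0 : ℝ)) (f := c) (l := gradient ρ) (l' := H)
        (by rwa [hc0]) (hc' 0)
      simpa [Function.comp_def] using this
    have h2 : HasDerivAt (fun t : ℝ => v + (2 * t) • w) ((2 : ℝ) • w) 0 := by
      simpa using (((hasDerivAt_id (0 : ℝ)).const_mul 2).smul_const w).const_add v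
    convert! h1.inner ℝ h2 using 1
    simp only [hc0, inner_smul_right, mul_zero, zero_smul, add_zero]
    rw [show gradient ρ p = g from rfl, hgw]
  have hmin : IsLocalMin (fun t => ρ (c t)) 0 := by
    have hde : deriv (fun t => ρ (c t)) =ᶠ[𝓝 0]
        fun t => inner ℝ (gradient ρ (c t)) (v + (2 * t) • w) := hd.mono fun t ht => ht.deriv
    refine isLocalMin_of_deriv_deriv_pos ?_ ?_ hd.self_of_nhds.continuousAt
    · rw [hde.deriv_eq, hdd.deriv]; linarith
    · rw [hde.self_of_nhds]; simp only [hc0, mul_zero, zero_smul, add_zero]; exact hv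
  have hnorm : ∀ t, ‖c t - y‖ ^ 2 - ‖p - y‖ ^ 2
      = t ^ 2 * (‖v‖ ^ 2 - 2 * l * s + 2 * t * inner ℝ v w + t ^ 2 * ‖w‖ ^ 2) := fun t => by
    have : c t - y = t • v + t ^ 2 • w - l • g := by simp only [hc, hy]; abel
    rw [this, hy]
    have : p - (p + l • g) = -(l • g) := by abel
    rw [this, norm_neg, norm_sub_sq_real, norm_add_sq_real]
    simp only [inner_add_left, inner_smul_left, inner_smul_right, norm_smul, mul_pow,
      Real.norm_eq_abs, sq_abs, RCLike.conj_to_real]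
    rw [real_inner_comm g v, real_inner_comm g w, hv, hgw]
    ring
  have hev : ∀ᶠ t in 𝓝 (0 : ℝ),
      ‖v‖ ^ 2 - 2 * l * s + 2 * t * inner ℝ v w + t ^ 2 * ‖w‖ ^ 2 < 0 := by
    have : Continuous fun t : ℝ =>
      ‖v‖ ^ 2 - 2 * l * s + 2 * t * inner ℝ v w + t ^ 2 * ‖w‖ ^ 2 := by fun_prop
    refine this.continuousAt.eventually_lt continuousAt_const ?_
    rw [lt_div_iff_of_neg (by linarith)] at hs2
    simp; linarith
  have hall := (hmin.and (hev.and (hcc.eventually h))).filter_mono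
    (nhdsWithin_le_nhds (s := Ioi 0))
  obtain ⟨t, ⟨h1, h2, h3⟩, ht⟩ := (hall.and self_mem_nhdsWithin).exists
  have ht : 0 < t := ht
  have h4 := hnorm t
  have h5 := mul_neg_of_pos_of_neg (pow_pos ht 2) h2
  have h6 := h3 (lt_of_pow_lt_pow_left₀ 2 (norm_nonneg _) (by linarith))
  simp only [hc0, hp] at h1
  linarith

end EuclideanGeometry

section NormalCoordinates

variable {E : Type*} [NormedAddCommGroup E] [InnerProductSpace ℝ E] [FiniteDimensional ℝ E]

/-- Inverse function theorem for `(q, l) ↦ (q + l ∇ρ(q), ρ(q))`. -/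
lemma exists_normal_coordinates {n : ℕ} (hn : n ≠ 0) {ρ : E → ℝ} {p : E} {l₀ : ℝ}
    (hρ : ContDiffAt ℝ (n + 1) ρ p) (hp : ρ p = 0) (hg : gradient ρ p ≠ 0)
    (hnd : ∀ v, inner ℝ (gradient ρ p) v = 0 →
      ‖v‖ ^ 2 + l₀ * inner ℝ (fderiv ℝ (gradient ρ) p v) v = 0 → v = 0) :
    ∃ (q : E → E) (l : E → ℝ), ContDiffAt ℝ n q (p + l₀ • gradient ρ p) ∧
      q (p + l₀ • gradient ρ p) = p ∧
      (∀ᶠ y in 𝓝 (p + l₀ • gradient ρ p), y = q y + l y • gradient ρ (q y) ∧ ρ (q y) = 0) ∧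
      ∀ᶠ a : E × ℝ in 𝓝 (p, l₀), ρ a.1 = 0 →
        q (a.1 + a.2 • gradient ρ a.1) = a.1 := by
  have hn' : (n : WithTop ℕ∞) ≠ 0 := by exact_mod_cast hn
  have hρ1 : DifferentiableAt ℝ ρ p := hρ.differentiableAt (by simp)
  have hgc : ContDiffAt ℝ n (gradient ρ) p := hρ.gradient_right
  have hρn : ContDiffAt ℝ n ρ p := hρ.of_le (by exact_mod_cast Nat.le_succ n)
  set H := fderiv ℝ (gradient ρ) p
  have hgr : HasFDerivAt (gradient ρ) H p := (hgc.differentiableAt hn').hasFDerivAt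
  let G : E × ℝ → E × ℝ := fun a => (a.1 + a.2 • gradient ρ a.1, ρ a.1)
  have hG : ContDiffAt ℝ n G (p, l₀) := by
    have h1 : ContDiffAt ℝ n (fun a : E × ℝ => gradient ρ a.1) (p, l₀) :=
      ContDiffAt.comp (p, l₀) (f := Prod.fst) (g := gradient ρ) hgc contDiffAt_fst
    have h2 : ContDiffAt ℝ n (fun a : E × ℝ => ρ a.1) (p, l₀) :=
      ContDiffAt.comp (p, l₀) (f := Prod.fst) (g := ρ) hρn contDiffAt_fst
    exact (contDiffAt_fst.add (contDiffAt_snd.smul h1)).prodMk h2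
  let L : E × ℝ →L[ℝ] E × ℝ :=
    (ContinuousLinearMap.fst ℝ E ℝ + (l₀ • (H.comp (ContinuousLinearMap.fst ℝ E ℝ)) +
      (ContinuousLinearMap.snd ℝ E ℝ).smulRight (gradient ρ p))).prod
      ((fderiv ℝ ρ p).comp (ContinuousLinearMap.fst ℝ E ℝ))
  have hL : HasFDerivAt G L (p, l₀) := by
    have h0 : HasFDerivAt (Prod.fst : E × ℝ → E) (ContinuousLinearMap.fst ℝ E ℝ) (p, l₀) :=
      hasFDerivAt_fst
    have h0' : HasFDerivAt (Prod.snd : E × ℝ → ℝ) (ContinuousLinearMap.snd ℝ E ℝ) (p, l₀) :=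
      hasFDerivAt_snd
    have h1 : HasFDerivAt (fun a : E × ℝ => gradient ρ a.1)
        (H.comp (ContinuousLinearMap.fst ℝ E ℝ)) (p, l₀) :=
      HasFDerivAt.comp (p, l₀) (f := Prod.fst) (g := gradient ρ) hgr h0
    have h2 : HasFDerivAt (fun a : E × ℝ => ρ a.1)
        ((fderiv ℝ ρ p).comp (ContinuousLinearMap.fst ℝ E ℝ)) (p, l₀) :=
      HasFDerivAt.comp (p, l₀) (f := Prod.fst) (g := ρ) hρ1.hasFDerivAt h0
    exact (h0.add (h0'.smul h1)).prodMk h2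
  have hinj : Function.Injective (L : E × ℝ →ₗ[ℝ] E × ℝ) := by
    rw [← LinearMap.ker_eq_bot, LinearMap.ker_eq_bot']
    rintro ⟨v, μ⟩ h
    have h1 : v + (l₀ • H v + μ • gradient ρ p) = 0 := congrArg Prod.fst h
    have h2 : fderiv ℝ ρ p v = 0 := congrArg Prod.snd h
    rw [← inner_gradient_left] at h2
    have h3 : ‖v‖ ^ 2 + l₀ * inner ℝ (H v) v = 0 := by
      have : inner ℝ (v + (l₀ • H v + μ • gradient ρ p)) v = 0 := by rw [h1, inner_zero_left]
      rw [inner_add_left, inner_add_left, real_inner_smul_left, real_inner_smul_left, h2,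
        real_inner_self_eq_norm_sq] at this
      linarith
    have hv := hnd v h2 h3
    subst hv
    simp only [map_zero, smul_zero, zero_add, smul_eq_zero, hg, or_false] at h1
    rw [h1]; rfl
  let L' : (E × ℝ) ≃L[ℝ] E × ℝ := (LinearEquiv.ofInjectiveEndo _ hinj).toContinuousLinearEquiv
  have hL' : HasFDerivAt G (L' : E × ℝ →L[ℝ] E × ℝ) (p, l₀) := by
    convert! hL
  have hs := hG.hasStrictFDerivAt' hL' hn'
  set Ψ := hG.localInverse hL' hn'
  have hG0 : G (p, l₀) = (p + l₀ • gradient ρ p, 0) := by simp [G, hp]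
  have hΨc : ContDiffAt ℝ n Ψ (p + l₀ • gradient ρ p, 0) := hG0 ▸ hG.to_localInverse hL' hn'
  have hcomp : ContDiffAt ℝ n (fun y => Ψ (y, 0)) (p + l₀ • gradient ρ p) :=
    ContDiffAt.comp (p + l₀ • gradient ρ p) (f := fun y : E => (y, (0 : ℝ))) (g := Ψ) hΨc
      (contDiffAt_id.prodMk contDiffAt_const)
  have htend : Tendsto (fun y : E => (y, (0 : ℝ))) (𝓝 (p + l₀ • gradient ρ p))
      (𝓝 (p + l₀ • gradient ρ p, 0)) := by
    have : Continuous (fun y : E => (y, (0 : ℝ))) := by fun_prop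
    exact this.tendsto _
  refine ⟨fun y => (Ψ (y, 0)).1, fun y => (Ψ (y, 0)).2, contDiffAt_fst.comp _ hcomp,
    ?_, ?_, ?_⟩
  · show (Ψ (p + l₀ • gradient ρ p, 0)).1 = p
    rw [← hG0]
    exact congrArg Prod.fst (hG.localInverse_apply_image hL' hn')
  · filter_upwards [htend.eventually (hG0 ▸ hs.eventually_right_inverse)] with y hy
    exact ⟨(congrArg Prod.fst hy).symm, congrArg Prod.snd hy⟩
  · filter_upwards [hs.eventually_left_inverse] with a ha h0
    have ha' : Ψ (a.1 + a.2 • gradient ρ a.1, 0) = a := by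
      have : G a = (a.1 + a.2 • gradient ρ a.1, 0) := by simp [G, h0]
      rw [← this]; exact ha
    exact congrArg Prod.fst ha'

/-- The signed distance to `{ρ = 0}` along normals is as smooth as `ρ` away from focal points. -/
lemma exists_contDiffAt_normal_distance {n : ℕ} (hn : n ≠ 0) {ρ : E → ℝ} {p : E} {l₀ : ℝ}
    (hρ : ContDiffAt ℝ (n + 1) ρ p) (hp : ρ p = 0) (hg : gradient ρ p ≠ 0)
    (hnd : ∀ v, inner ℝ (gradient ρ p) v = 0 →
      ‖v‖ ^ 2 + l₀ * inner ℝ (fderiv ℝ (gradient ρ) p v) v = 0 → v = 0) :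
    ∃ δ : E → ℝ, ContDiffAt ℝ (n + 1) δ (p + l₀ • gradient ρ p) ∧
      ∀ᶠ a : E × ℝ in 𝓝 (p, l₀), ρ a.1 = 0 →
        δ (a.1 + a.2 • gradient ρ a.1) = -a.2 * ‖gradient ρ a.1‖ := by
  obtain ⟨q, l, hq, hq0, hr, hleft⟩ := exists_normal_coordinates hn hρ hp hg hnd
  have hn' : (n : WithTop ℕ∞) ≠ 0 := by exact_mod_cast hn
  have hgc : ContDiffAt ℝ n (gradient ρ) p := hρ.gradient_right
  set x := p + l₀ • gradient ρ p
  have hgq : ContDiffAt ℝ n (fun y => gradient ρ (q y)) x :=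
    ContDiffAt.comp x (f := q) (g := gradient ρ) (by rwa [hq0]) hq
  have hg0 : gradient ρ (q x) ≠ 0 := by rwa [hq0]
  let N : E → E := fun y => -(‖gradient ρ (q y)‖⁻¹ • gradient ρ (q y))
  have hN : ContDiffAt ℝ n N x :=
    (((hgq.norm ℝ hg0).inv (norm_ne_zero_iff.2 hg0)).smul hgq).neg
  have hρq : ∀ᶠ y in 𝓝 x, DifferentiableAt ℝ ρ (q y) := by
    have : ∀ᶠ z in 𝓝 (q x), DifferentiableAt ℝ ρ z := by
      rw [hq0]
      exact ((hρ.of_le (m := 1) (by simp)).eventually (by simp)).mono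
        fun z hz => hz.differentiableAt (by simp)
    exact hq.continuousAt.eventually this
  have hdiff : ∀ {f : E → E}, ContDiffAt ℝ n f x → ∀ᶠ y in 𝓝 x, DifferentiableAt ℝ f y :=
    fun hf => (hf.eventually (by simp)).mono fun z hz => hz.differentiableAt hn'
  have hne : ∀ᶠ y in 𝓝 x, gradient ρ (q y) ≠ 0 := hgq.continuousAt.eventually_ne hg0
  refine ⟨fun y => inner ℝ (y - q y) (N y), ?_, ?_⟩
  · rw [contDiffAt_succ_iff_hasFDerivAt]
    refine ⟨fun y => InnerProductSpace.toDual ℝ E (N y), ⟨_, ?_, fun y hy => hy⟩,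
      (InnerProductSpace.toDual ℝ E).toContinuousLinearEquiv.contDiff.contDiffAt.comp x hN⟩
    have hloc : ∀ᶠ y in 𝓝 x, ‖N y‖ ^ 2 = 1 := by
      filter_upwards [hne] with y hy
      have := norm_ne_zero_iff.2 hy
      simp [N, norm_smul, this]
    filter_upwards [hr, hne, hρq, hdiff hq, hdiff hN, hr.eventually_nhds, hloc.eventually_nhds]
      with y h1 h2 h3 h4 h5 h6 h7
    have hgn := norm_ne_zero_iff.2 h2
    have d1 : ∀ v, inner ℝ (N y) (fderiv ℝ N y v) = 0 := by
      intro v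
      have e1 := (h5.hasFDerivAt.inner ℝ h5.hasFDerivAt)
      have e2 : HasFDerivAt (fun z => inner ℝ (N z) (N z)) (0 : E →L[ℝ] ℝ) y :=
        (hasFDerivAt_const (1 : ℝ) y).congr_of_eventuallyEq
          (h7.mono fun z hz => by simpa using hz)
      have e3 := DFunLike.congr_fun (e1.unique e2) v
      simp [fderivInnerCLM_apply] at e3
      rw [real_inner_comm (N y) (fderiv ℝ N y v)] at e3
      linarith
    have d2 : ∀ v, inner ℝ (fderiv ℝ q y v) (N y) = 0 := by
      intro v
      have e1 := h3.hasFDerivAt.comp y h4.hasFDerivAt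
      have e2 : HasFDerivAt (ρ ∘ q) (0 : E →L[ℝ] ℝ) y :=
        (hasFDerivAt_const (0 : ℝ) y).congr_of_eventuallyEq (h6.mono fun z hz => hz.2)
      have e3 := DFunLike.congr_fun (e1.unique e2) v
      simp only [ContinuousLinearMap.comp_apply, zero_apply] at e3
      rw [← inner_gradient_left, real_inner_comm] at e3
      simp only [N, inner_neg_right, inner_smul_right, e3, mul_zero, neg_zero]
    have d3 : y - q y = (-(l y * ‖gradient ρ (q y)‖)) • N y := by
      have : y - q y = l y • gradient ρ (q y) := sub_eq_iff_eq_add'.2 h1.1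
      rw [this]
      simp only [N, smul_neg, smul_smul]
      rw [← neg_smul]
      congr 1
      field_simp
    have hfin : HasFDerivAt (fun z => inner ℝ (z - q z) (N z)) _ y :=
      ((hasFDerivAt_id y).sub h4.hasFDerivAt).inner ℝ h5.hasFDerivAt
    refine hfin.congr_fderiv ?_
    ext v
    simp only [ContinuousLinearMap.comp_apply, ContinuousLinearMap.prod_apply,
      fderivInnerCLM_apply, id, sub_apply, ContinuousLinearMap.id_apply,
      InnerProductSpace.toDual_apply_apply, Pi.sub_apply]
    rw [d3, real_inner_smul_left, d1, inner_sub_left, d2, real_inner_comm]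
    ring
  · have hcont : Tendsto (fun a : E × ℝ => a.1) (𝓝 (p, l₀)) (𝓝 p) := continuous_fst.tendsto _
    filter_upwards [hleft, hcont.eventually (hgc.continuousAt.eventually_ne hg)] with a ha hga h0
    have h1 := ha h0
    have hgn := norm_ne_zero_iff.2 hga
    simp only [N, h1, add_sub_cancel_left, inner_neg_right, inner_smul_right, real_inner_smul_left,
      real_inner_self_eq_norm_sq]
    field_simp

end NormalCoordinates

section NearestPoint

lemma IsCompact.tendsto_nearest {X : Type*} [MetricSpace X] {K : Set X} (hK : IsCompact K)
    {ξ : X → X} (hξ : ∀ y, ξ y ∈ K ∧ infDist y K = dist y (ξ y)) {x : X}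
    (huniq : ∀ z ∈ K, dist x z = infDist x K → z = ξ x) : Tendsto ξ (𝓝 x) (𝓝 (ξ x)) := by
  refine hK.tendsto_nhds_of_unique_mapClusterPt (.of_forall fun y => (hξ y).1) fun z hz hc => ?_
  obtain ⟨U, hU, hUz⟩ := mapClusterPt_iff_ultrafilter.1 hc
  have h1 : Tendsto (fun y => dist y (ξ y)) U (𝓝 (dist x z)) :=
    (tendsto_id.mono_left hU).dist hUz
  have h2 : Tendsto (fun y => infDist y K) U (𝓝 (infDist x K)) :=
    ((continuous_infDist_pt K).tendsto x).mono_left hU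
  exact huniq z hz (tendsto_nhds_unique h1 (h2.congr fun y => (hξ y).2))

variable {E : Type*} [NormedAddCommGroup E] [InnerProductSpace ℝ E] [FiniteDimensional ℝ E]

/-- If nearest points are unique on a ball around `x`, then `infDist · K` grows at unit rate from
`x` towards some point of the boundary sphere. -/
lemma exists_add_le_infDist_of_unique_nearest {K : Set E} (hK : IsCompact K) {ξ : E → E}
    (hξ : ∀ y, ξ y ∈ K ∧ infDist y K = dist y (ξ y)) {x : E} {r : ℝ} (hr : 0 < r)
    (hball : ∀ y ∈ closedBall x r, y ∉ K ∧ ∀ z ∈ K, dist y z = infDist y K → z = ξ y) :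
    ∃ y ∈ closedBall x r, infDist x K + r ≤ infDist y K := by
  have hcomp : IsCompact (closedBall x r) := isCompact_closedBall x r
  have hxb : x ∈ closedBall x r := mem_closedBall_self hr.le
  have hcont : Continuous fun y => infDist y K := continuous_infDist_pt K
  have key : ∀ c, 0 < c → c < 1 → ∃ y ∈ closedBall x r, infDist x K + c * r ≤ infDist y K := by
    intro c hc0 hc1
    have hcf : Continuous fun y => infDist y K - c * dist y x := by fun_prop
    obtain ⟨y, hy, hmax⟩ := hcomp.exists_isMaxOn ⟨x, hxb⟩ hcf.continuousOn
    refine ⟨y, hy, ?_⟩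
    have hyx := hmax hxb
    simp only [mem_ofPred_eq, dist_self, mul_zero, sub_zero] at hyx
    suffices dist y x = r by rw [this] at hyx; linarith
    by_contra hne
    have hlt : dist y x < r := lt_of_le_of_ne hy hne
    have hne0 : y - ξ y ≠ 0 := by
      intro h
      exact (hball y hy).1 (sub_eq_zero.1 h ▸ (hξ y).1)
    set e := ‖y - ξ y‖⁻¹ • (y - ξ y) with he
    have hen : ‖e‖ = 1 := by
      rw [he, norm_smul, norm_inv, norm_norm, inv_mul_cancel₀ (norm_ne_zero_iff.2 hne0)]
    have hline : Tendsto (fun t : ℝ => y + t • e) (𝓝 0) (𝓝 y) := by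
      have : Continuous fun t : ℝ => y + t • e := by fun_prop
      simpa using this.tendsto 0
    have hξt : Tendsto (fun t : ℝ => y - ξ (y + t • e)) (𝓝 0) (𝓝 (y - ξ y)) :=
      ((hK.tendsto_nearest hξ (hball y hy).2).comp hline).const_sub y
    have het : Tendsto (fun t : ℝ => inner ℝ e
        (‖y - ξ (y + t • e)‖⁻¹ • (y - ξ (y + t • e)))) (𝓝 0) (𝓝 1) := by
      have := (tendsto_const_nhds (x := e)).inner (𝕜 := ℝ)
        ((hξt.norm.inv₀ (norm_ne_zero_iff.2 hne0)).smul hξt)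
      rwa [← he, real_inner_self_eq_norm_sq, hen, one_pow] at this
    have hall := ((het.eventually_const_lt hc1).and ((hξt.eventually_ne hne0).and
      (hline.eventually (isOpen_ball.mem_nhds hlt)))).filter_mono
        (nhdsWithin_le_nhds (s := Ioi 0))
    obtain ⟨t, ⟨h1, h2, h3⟩, ht⟩ := (hall.and self_mem_nhdsWithin).exists
    have ht : 0 < t := ht
    have h4 := hmax (ball_subset_closedBall h3)
    simp only [mem_ofPred_eq] at h4
    have h5 : dist (y + t • e) x ≤ dist y x + t := by
      have := dist_triangle (y + t • e) y x
      rw [dist_self_add_left, norm_smul, hen, Real.norm_of_nonneg ht.le] at this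
      linarith
    set z := y - ξ (y + t • e) with hz
    have hzn := norm_pos_iff.2 h2
    have h6 : ‖z‖ + t * inner ℝ e (‖z‖⁻¹ • z) ≤ infDist (y + t • e) K := by
      rw [(hξ _).2, dist_eq_norm, show y + t • e - ξ (y + t • e) = z + t • e by rw [hz]; abel]
      have h7 := real_inner_le_norm (z + t • e) (‖z‖⁻¹ • z)
      rw [norm_smul, norm_inv, norm_norm, inv_mul_cancel₀ hzn.ne', mul_one, inner_add_left,
        real_inner_smul_left, inner_smul_right, real_inner_self_eq_norm_sq] at h7
      have : ‖z‖⁻¹ * ‖z‖ ^ 2 = ‖z‖ := by field_simp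
      linarith
    have h8 : infDist y K ≤ ‖z‖ := by
      rw [hz, ← dist_eq_norm]; exact infDist_le_dist_of_mem (hξ _).1
    nlinarith [mul_le_mul_of_nonneg_left h5 hc0.le, mul_lt_mul_of_pos_left h1 ht]
  obtain ⟨y, hy, hmax⟩ := hcomp.exists_isMaxOn ⟨x, hxb⟩ hcont.continuousOn
  refine ⟨y, hy, ?_⟩
  by_contra! hlt
  obtain ⟨c, hc, hc1⟩ := exists_between (max_lt ((div_lt_one hr).2 (by linarith))
    one_pos : max ((infDist y K - infDist x K) / r) 0 < 1)
  obtain ⟨z, hz, hz'⟩ := key c ((le_max_right _ _).trans_lt hc) hc1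
  have h1 := (div_lt_iff₀ hr).1 ((le_max_left _ _).trans_lt hc)
  have h2 : infDist z K ≤ infDist y K := hmax hz
  linarith

/-- Where nearest points are locally unique, the segment from the nearest point can be prolonged
beyond `x` while remaining minimizing. -/
lemma exists_one_lt_minimizing_of_unique_nearest {K : Set E} (hK : IsCompact K) {ξ : E → E}
    (hξ : ∀ y, ξ y ∈ K ∧ infDist y K = dist y (ξ y)) {x : E} {r : ℝ} (hr : 0 < r)
    (hball : ∀ y ∈ closedBall x r, y ∉ K ∧ ∀ z ∈ K, dist y z = infDist y K → z = ξ y) :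
    ∃ s : ℝ, 1 < s ∧ ∀ q ∈ K, s * ‖x - ξ x‖ ≤ dist (ξ x + s • (x - ξ x)) q := by
  obtain ⟨y, hy, hle⟩ := exists_add_le_infDist_of_unique_nearest hK hξ hr hball
  have hx0 : x - ξ x ≠ 0 := fun h =>
    (hball x (mem_closedBall_self hr.le)).1 (sub_eq_zero.1 h ▸ (hξ x).1)
  have hxn := norm_pos_iff.2 hx0
  rw [(hξ x).2, dist_eq_norm] at hle
  rw [mem_closedBall, dist_eq_norm] at hy
  have h1 : infDist y K ≤ ‖y - ξ x‖ := by
    rw [← dist_eq_norm]; exact infDist_le_dist_of_mem (hξ x).1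
  have h2 : y - ξ x = (x - ξ x) + (y - x) := by abel
  have h3 := norm_add_le (x - ξ x) (y - x)
  rw [← h2] at h3
  have h4 : ‖y - x‖ = r := by linarith
  have h5 : SameRay ℝ (x - ξ x) (y - x) := by
    rw [sameRay_iff_norm_add, ← h2]; linarith
  have h6 := h5.norm_smul_eq
  rw [h4] at h6
  have hs : ξ x + (1 + r / ‖x - ξ x‖) • (x - ξ x) = y := by
    have : (r / ‖x - ξ x‖) • (x - ξ x) = y - x := by
      rw [div_eq_inv_mul, mul_smul, ← h6, smul_smul, inv_mul_cancel₀ hxn.ne', one_smul]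
    rw [add_smul, one_smul, this]; abel
  refine ⟨1 + r / ‖x - ξ x‖, by have := div_pos hr hxn; linarith, fun q hq => ?_⟩
  rw [hs, add_mul, one_mul, div_mul_cancel₀ _ hxn.ne']
  exact hle.trans (infDist_le_dist_of_mem hq)

end NearestPoint

section BoundaryDistance

variable {E : Type*} [NormedAddCommGroup E] [InnerProductSpace ℝ E] [FiniteDimensional ℝ E]

/-- The boundary distance is `C^k` at points with a unique nearest boundary point whose minimizing
segment can be prolonged. -/
lemma contDiffWithinAt_infDist_frontier {n : ℕ} (hn : n ≠ 0) {Ω : Set E} (hΩ : IsOpen Ω)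
    (hK : IsCompact (frontier Ω)) (hCk : HasCkBoundary Ω ((n + 1 : ℕ) : ℕ∞)) {ξ : E → E}
    (hξ : ∀ y, ξ y ∈ frontier Ω ∧ infDist y (frontier Ω) = dist y (ξ y)) {x : E}
    (hx : x ∈ closure Ω) (huniq : ∀ z ∈ frontier Ω, dist x z = infDist x (frontier Ω) → z = ξ x)
    {s : ℝ} (hs : 1 < s)
    (hmin : ∀ q ∈ frontier Ω, s * ‖x - ξ x‖ ≤ dist (ξ x + s • (x - ξ x)) q) :
    ContDiffWithinAt ℝ (n + 1) (fun x => infDist x (frontier Ω)) (closure Ω) x := by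
  have hclos : ∀ y ∈ closure Ω, y ∈ Ω ∨ y - ξ y = 0 := by
    intro y hy
    by_cases h : y ∈ Ω
    · exact .inl h
    · right
      have hyf : y ∈ frontier Ω := by rw [hΩ.frontier_eq]; exact ⟨hy, h⟩
      have := (hξ y).2
      rw [infDist_zero_of_mem hyf] at this
      exact sub_eq_zero.2 (dist_eq_zero.1 this.symm)
  obtain ⟨V, ρ, hV, hpV, hρV, hρ0, hΩV, hfV⟩ := hCk (ξ x) (hξ x).1
  have hξt : Tendsto ξ (𝓝 x) (𝓝 (ξ x)) := hK.tendsto_nearest hξ huniq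
  set p := ξ x with hp
  have hρ : ContDiffAt ℝ (n + 1) ρ p := by
    simpa using hρV.contDiffAt (hV.mem_nhds hpV)
  have hdiff : ∀ q ∈ V, DifferentiableAt ℝ ρ q := fun q hq =>
    (hρV.contDiffAt (hV.mem_nhds hq)).differentiableAt (by simp)
  have hgrad : ∀ q ∈ V ∩ frontier Ω, gradient ρ q ≠ 0 := by
    intro q hq h
    refine hρ0 q hq (ContinuousLinearMap.ext fun v => ?_)
    rw [← inner_gradient_left, h, inner_zero_left, zero_apply]
  have hzero : ∀ q ∈ V ∩ frontier Ω, ρ q = 0 := fun q hq =>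
    ((Set.ext_iff.1 hfV q).1 ⟨hq.2, hq.1⟩).2
  have hneg : ∀ q ∈ V ∩ frontier Ω, ∀ y, ball y (dist y q) ⊆ Ω →
      ∀ᶠ z in 𝓝 q, ‖z - y‖ < ‖q - y‖ → ρ z < 0 := by
    intro q hq y hy
    filter_upwards [hV.mem_nhds hq.1] with z hz hzy
    refine ((Set.ext_iff.1 hΩV z).1 ⟨hy ?_, hz⟩).2
    rwa [mem_ball, dist_eq_norm, dist_comm, dist_eq_norm]
  have hrep : ∀ q ∈ V ∩ frontier Ω, ∀ y, ball y (dist y q) ⊆ Ω →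
      y = q + (-(‖y - q‖ / ‖gradient ρ q‖)) • gradient ρ q := by
    intro q hq y hy
    have h1 := norm_smul_sub_eq_of_ball_neg (hdiff q hq.1) (hzero q hq) (hneg q hq y hy)
    have hg := norm_ne_zero_iff.2 (hgrad q hq)
    have h2 : y - q = (-(‖y - q‖ / ‖gradient ρ q‖)) • gradient ρ q := by
      rw [neg_smul, div_eq_inv_mul, mul_smul, ← smul_neg, ← h1, smul_smul, inv_mul_cancel₀ hg,
        one_smul]
    rw [← h2]; abel
  have hball : ∀ y ∈ closure Ω, ball y (dist y (ξ y)) ⊆ Ω := by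
    intro y hy
    rcases hclos y hy with h | h
    · by_cases h0 : dist y (ξ y) ≤ 0
      · simp [ball_eq_empty.2 h0]
      · refine ball_subset_of_le_dist_frontier hΩ h (mem_ball_self (not_le.1 h0)) fun q hq => ?_
        rw [← (hξ y).2]; exact infDist_le_dist_of_mem hq
    · simp [dist_eq_zero.2 (sub_eq_zero.1 h)]
  have hpf : p ∈ V ∩ frontier Ω := ⟨hpV, (hξ x).1⟩
  have hg := hgrad p hpf
  set g := gradient ρ p with hgdef
  set l₀ := -(‖x - p‖ / ‖g‖) with hl₀
  have hl₀' : l₀ ≤ 0 := neg_nonpos.2 (by positivity)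
  have hxp : x = p + l₀ • g := hrep p hpf x (hball x hx)
  set x' := p + s • (x - p) with hx'
  have hdist : dist x' p = s * ‖x - p‖ := by
    rw [hx', dist_self_add_left, norm_smul, Real.norm_of_nonneg (by linarith)]
  have hball' : ball x' (dist x' p) ⊆ Ω := by
    rcases hclos x hx with h | h
    · by_cases h0 : x - p = 0
      · simp [hdist, h0]
      · refine ball_subset_of_le_dist_frontier hΩ h ?_ fun q hq => hdist ▸ hmin q hq
        have h1 : x - x' = (1 - s) • (x - p) := by rw [hx', sub_smul, one_smul]; abel
        rw [mem_ball, hdist, dist_eq_norm, h1, norm_smul, Real.norm_of_nonpos (by linarith)]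
        nlinarith [norm_pos_iff.2 h0]
    · simp [hdist, show x - p = 0 from h]
  have hx'p : x' = p + (s * l₀) • g := by
    rw [hx', mul_smul]
    congr 2
    exact sub_eq_iff_eq_add'.2 hxp
  have hnd : ∀ v, inner ℝ g v = 0 →
      ‖v‖ ^ 2 + l₀ * inner ℝ (fderiv ℝ (gradient ρ) p v) v = 0 → v = 0 := by
    intro v hv h0
    have h1 := sq_norm_add_mul_inner_nonneg_of_ball_neg
      (hρ.of_le (by exact_mod_cast Nat.succ_le_succ (Nat.pos_of_ne_zero hn))) (hzero p hpf) hg hx'p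
      (mul_nonpos_of_nonneg_of_nonpos (by linarith) hl₀') (hneg p hpf x' hball') hv
    have h2 : ‖v‖ ^ 2 ≤ 0 := by nlinarith [sq_nonneg ‖v‖]
    simpa using le_antisymm h2 (sq_nonneg _)
  obtain ⟨δ, hδ, hδe⟩ := exists_contDiffAt_normal_distance hn hρ (hzero p hpf) hg hnd
  rw [← hgdef, ← hxp] at hδ
  have hgt : Tendsto (fun y => gradient ρ (ξ y)) (𝓝 x) (𝓝 g) :=
    (hρ.gradient_right.continuousAt.tendsto).comp hξt
  have hpair : Tendsto (fun y => (ξ y, -(‖y - ξ y‖ / ‖gradient ρ (ξ y)‖))) (𝓝 x)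
      (𝓝 (p, l₀)) :=
    hξt.prodMk_nhds ((((tendsto_id (x := 𝓝 x)).sub hξt).norm.div hgt.norm
      (norm_ne_zero_iff.2 hg)).neg)
  have hev : ∀ᶠ y in 𝓝 x, y ∈ closure Ω → infDist y (frontier Ω) = δ y := by
    filter_upwards [hpair.eventually hδe, hξt.eventually (hV.mem_nhds hpV)] with y h1 h2 hy
    have hyV : ξ y ∈ V ∩ frontier Ω := ⟨h2, (hξ y).1⟩
    have h3 := h1 (hzero _ hyV)
    rw [← hrep _ hyV y (hball y hy), neg_neg,
      div_mul_cancel₀ _ (norm_ne_zero_iff.2 (hgrad _ hyV))] at h3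
    rw [h3, (hξ y).2, dist_eq_norm]
  exact hδ.contDiffWithinAt.congr_of_eventuallyEq (eventually_nhdsWithin_iff.2 hev)
    (hev.self_of_nhds hx)

end BoundaryDistance

/-- Theorem (statement 19, Gilbarg–Trudinger type regularity): if `Ω ⊆ ℝᵐ` is a bounded
domain with `C^k`-smooth boundary, `k ≥ 2`, then the distance function `d_{∂Ω}` is `C^k`
smooth on `cl(Ω) \ Σ`, where `Σ` is the cut locus of `Ω`. -/
theorem distance_function_regularity (m : ℕ) (k : ℕ) (hk : 2 ≤ k)
    (Ω : Set (EuclideanSpace ℝ (Fin m)))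
    (hopen : IsOpen Ω) (hconn : IsConnected Ω) (hbdd : Bornology.IsBounded Ω)
    (hCk : HasCkBoundary Ω k) :
    ContDiffOn ℝ k (fun x => infDist x (frontier Ω)) (closure Ω \ cutLocus Ω) := by
  rcases (frontier Ω).eq_empty_or_nonempty with hempty | hne
  · simp only [hempty, infDist_empty]
    exact contDiffOn_const
  obtain ⟨n, rfl⟩ : ∃ n, k = n + 1 := ⟨k - 1, by omega⟩
  have hK : IsCompact (frontier Ω) :=
    isCompact_of_isClosed_isBounded isClosed_frontier (hbdd.closure.subset frontier_subset_closure)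
  choose ξ hξ using fun y => hK.exists_infDist_eq_dist hne y
  rintro x ⟨hx, hxc⟩
  refine ContDiffWithinAt.mono ?_ sdiff_subset
  rw [Nat.cast_add_one]
  by_cases hxΩ : x ∈ Ω
  · have hxm : x ∈ Ω ∩ (closure (medialAxis Ω))ᶜ := ⟨hxΩ, fun h => hxc ⟨h, hxΩ⟩⟩
    obtain ⟨r, hr, hrs⟩ := nhds_basis_closedBall.mem_iff.1
      ((hopen.inter isClosed_closure.isOpen_compl).mem_nhds hxm)
    have hball : ∀ y ∈ closedBall x r, y ∉ frontier Ω ∧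
        ∀ z ∈ frontier Ω, dist y z = infDist y (frontier Ω) → z = ξ y := by
      intro y hy
      obtain ⟨hyΩ, hym⟩ := hrs hy
      refine ⟨fun h => ((hopen.frontier_eq ▸ h : y ∈ closure Ω \ Ω)).2 hyΩ, fun z hz hd => ?_⟩
      by_contra hzne
      exact hym (subset_closure ⟨hyΩ, z, hz, ξ y, (hξ y).1, hzne, hd, (hξ y).2.symm⟩)
    obtain ⟨s, hs, hmin⟩ := exists_one_lt_minimizing_of_unique_nearest hK hξ hr hball
    exact contDiffWithinAt_infDist_frontier (by omega) hopen hK hCk hξ hx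
      (hball x (mem_closedBall_self hr.le)).2 hs hmin
  · have hxf : x ∈ frontier Ω := by rw [hopen.frontier_eq]; exact ⟨hx, hxΩ⟩
    have h0 := infDist_zero_of_mem hxf
    have hξx : x = ξ x := dist_eq_zero.1 ((hξ x).2.symm.trans h0)
    refine contDiffWithinAt_infDist_frontier (s := 2) (by omega) hopen hK hCk hξ hx
      (fun z _ hz => ?_) one_lt_two fun q _ => ?_
    · rw [← hξx, dist_eq_zero.1 (hz.trans h0)]
    · simp [← hξx]

end
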